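/- arXiv:1612.03663 — 2 statements merged into one kernel-verified Lean document; each statement's English description precedes it below -/
import Mathlib

section
/- Fix m ≥ 2, 1 ≤ k ≤ m − 1, λ > 0, n ≥ 1, a label y ∈ {1,…,m}, K_ii > 0, and q ∈ ℝ^m. Let L* be the conjugate of the top-k entropy loss: L*(w) = Σ_{j ≠ y} w_j log w_j + (1 + w_y) log(1 + w_y) if ⟨1, w⟩ = 0 and w^{\y} ∈ Δ^α_k, and +∞ otherwise (with 0·log 0 = 0). Consider maximizing over v ∈ ℝ^m the function D_i(v) = −(1/n)·L*(−λ n v) − (λ/2)( K_ii·⟨v, v⟩ + 2⟨q, v⟩ ). Then v maximizes D_i if and only if ⟨1, v⟩ = 0 and −v^{\y} = (1/(λn))·x*, where x* is the unique minimizer over x ∈ Δ^α_k of (α/2)( ⟨x, x⟩ + s² ) − ⟨b, x⟩ + ⟨x, log x⟩ + (1 − s) log(1 − s) with s = ⟨1, x⟩, α = K_ii/(λn), and b = q^{\y} − q_y·1. -/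
open Finset

/-- Membership in the top-k simplex `Δ^α_k(r)` of `ℝ^{m-1}` (coordinates indexed by
`j ≠ y`). -/
def inTopkSimplex (k : ℕ) {m : ℕ} (y : Fin m) (r : ℝ)
    (x : {j : Fin m // j ≠ y} → ℝ) : Prop :=
  (∑ j, x j ≤ r) ∧ ∀ j, 0 ≤ x j ∧ x j ≤ (1/(k:ℝ)) * ∑ l, x l

/-- The dual SDCA objective for the top-k entropy loss, evaluated at a feasible `v`:
`D_i(v) = −(1/n)·L*(−λnv) − (λ/2)(K_ii⟨v,v⟩ + 2⟨q,v⟩)`, where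
`L*(w) = ∑_{j≠y} w_j log w_j + (1 + w_y) log(1 + w_y)` (with `0·log 0 = 0`). -/
noncomputable def dualObjEnt {m : ℕ} (lam Kii : ℝ) (n : ℕ) (y : Fin m)
    (q v : Fin m → ℝ) : ℝ :=
  -(1/(n:ℝ)) *
      ((∑ j : {j : Fin m // j ≠ y},
          (-((lam * n) * v j.1)) * Real.log (-((lam * n) * v j.1))) +
        (1 + (-((lam * n) * v y))) * Real.log (1 + (-((lam * n) * v y)))) -
    (lam/2) * (Kii * ∑ j, (v j)^2 + 2 * ∑ j, q j * v j)

/-- The proximal objective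
`(α/2)(⟨x,x⟩ + s²) − ⟨b,x⟩ + ⟨x, log x⟩ + (1 − s)log(1 − s)` with `s = ⟨1,x⟩`,
`α = K_ii/(λn)` and `b = q^{\y} − q_y·1`. -/
noncomputable def proxObjEnt {m : ℕ} (lam Kii : ℝ) (n : ℕ) (y : Fin m)
    (q : Fin m → ℝ) (x : {j : Fin m // j ≠ y} → ℝ) : ℝ :=
  (Kii / (lam * n)) / 2 * ((∑ j, (x j)^2) + (∑ j, x j)^2) -
    (∑ j, (q j.1 - q y) * x j) + (∑ j, x j * Real.log (x j)) +
    (1 - ∑ j, x j) * Real.log (1 - ∑ j, x j)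


lemma sum_split_ne {m : ℕ} (y : Fin m) (f : Fin m → ℝ) :
    ∑ j, f j = f y + ∑ j : {j : Fin m // j ≠ y}, f j.1 :=
  Fintype.sum_eq_add_sum_subtype_ne f y

lemma dual_eq_prox {m : ℕ} (n : ℕ) (hn : 1 ≤ n) (lam Kii : ℝ) (hlam : 0 < lam)
    (y : Fin m) (q v : Fin m → ℝ) (hv : ∑ j, v j = 0) :
    dualObjEnt lam Kii n y q v =
      -(1/(n:ℝ)) * proxObjEnt lam Kii n y q (fun j => -((lam * n) * v j.1)) := by
  have hn0 : (n:ℝ) ≠ 0 := by positivity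
  have hl : lam ≠ 0 := hlam.ne'
  unfold dualObjEnt proxObjEnt
  rw [sum_split_ne y] at hv
  rw [sum_split_ne y (fun j => v j ^ 2), sum_split_ne y (fun j => q j * v j)]
  have e1 : ∑ j : {j : Fin m // j ≠ y}, -((lam * n) * v j.1) = lam * n * v y := by
    rw [Finset.sum_neg_distrib, ← Finset.mul_sum]
    linear_combination (-(lam * n)) * hv
  have e2 : ∑ j : {j : Fin m // j ≠ y}, (-((lam * n) * v j.1)) ^ 2
      = (lam * n) ^ 2 * ∑ j : {j : Fin m // j ≠ y}, v j.1 ^ 2 := by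
    rw [Finset.mul_sum]; exact Finset.sum_congr rfl fun j _ => by ring
  have e3 : ∑ j : {j : Fin m // j ≠ y}, (q j.1 - q y) * (-((lam * n) * v j.1))
      = -(lam * n) * (∑ j : {j : Fin m // j ≠ y}, q j.1 * v j.1 + q y * v y) := by
    have : v y = - ∑ j : {j : Fin m // j ≠ y}, v j.1 := by linarith
    rw [this, mul_neg, Finset.mul_sum, ← sub_eq_add_neg, ← Finset.sum_sub_distrib, Finset.mul_sum]
    exact Finset.sum_congr rfl fun j _ => by ring
  rw [e1, e2, e3, ← sub_eq_add_neg 1]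
  generalize (∑ j : {j : Fin m // j ≠ y}, -(lam * n * v j.1) * Real.log (-(lam * n * v j.1))) = E
  generalize Real.log (1 - lam * n * v y) = G
  field_simp
  ring

lemma mul_log_mid (a b : ℝ) (ha : 0 ≤ a) (hb : 0 ≤ b) :
    ((a + b) / 2) * Real.log ((a + b) / 2) ≤ (a * Real.log a + b * Real.log b) / 2 := by
  have h := Real.convexOn_mul_log.2 (show a ∈ Set.Ici (0:ℝ) from ha) (show b ∈ Set.Ici (0:ℝ) from hb)
    (show (0:ℝ) ≤ 1/2 by norm_num) (show (0:ℝ) ≤ 1/2 by norm_num) (by norm_num)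
  simp only [smul_eq_mul] at h
  have e : 1 / 2 * a + 1 / 2 * b = (a + b) / 2 := by ring
  rw [e] at h
  linarith

lemma topk_mid {m k : ℕ} (y : Fin m) (x z : {j : Fin m // j ≠ y} → ℝ)
    (hx : inTopkSimplex k y 1 x) (hz : inTopkSimplex k y 1 z) :
    inTopkSimplex k y 1 (fun j => (x j + z j) / 2) := by
  have e : ∑ j, (x j + z j) / 2 = (∑ j, x j + ∑ j, z j) / 2 := by
    rw [← Finset.sum_div, Finset.sum_add_distrib]
  refine ⟨?_, fun j => ⟨?_, ?_⟩⟩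
  · rw [e]; linarith [hx.1, hz.1]
  · linarith [(hx.2 j).1, (hz.2 j).1]
  · rw [e]; linarith [(hx.2 j).2, (hz.2 j).2]

lemma prox_mid {m k : ℕ} (n : ℕ) (hn : 1 ≤ n) (lam Kii : ℝ) (hlam : 0 < lam) (hK : 0 < Kii)
    (y : Fin m) (q : Fin m → ℝ) (x z : {j : Fin m // j ≠ y} → ℝ)
    (hx : inTopkSimplex k y 1 x) (hz : inTopkSimplex k y 1 z) :
    proxObjEnt lam Kii n y q (fun j => (x j + z j) / 2) +
      (Kii / (lam * n)) / 8 * ∑ j, (x j - z j) ^ 2 ≤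
      (proxObjEnt lam Kii n y q x + proxObjEnt lam Kii n y q z) / 2 := by
  have hα : 0 < Kii / (lam * n) := by positivity
  unfold proxObjEnt
  generalize Kii / (lam * n) = α at *
  have e : ∑ j, (x j + z j) / 2 = (∑ j, x j + ∑ j, z j) / 2 := by
    rw [← Finset.sum_div, Finset.sum_add_distrib]
  have e2 : ∑ j, ((x j + z j) / 2) ^ 2 =
      (∑ j, x j ^ 2 + ∑ j, z j ^ 2) / 2 - (∑ j, (x j - z j) ^ 2) / 4 := by
    rw [← Finset.sum_add_distrib, Finset.sum_div, Finset.sum_div, ← Finset.sum_sub_distrib]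
    exact Finset.sum_congr rfl fun j _ => by ring
  have e3 : ∑ j, (q j.1 - q y) * ((x j + z j) / 2) =
      (∑ j, (q j.1 - q y) * x j + ∑ j, (q j.1 - q y) * z j) / 2 := by
    rw [← Finset.sum_add_distrib, Finset.sum_div]
    exact Finset.sum_congr rfl fun j _ => by ring
  have e4 : ∑ j, ((x j + z j) / 2) * Real.log ((x j + z j) / 2) ≤
      (∑ j, x j * Real.log (x j) + ∑ j, z j * Real.log (z j)) / 2 := by
    rw [← Finset.sum_add_distrib, Finset.sum_div]
    exact Finset.sum_le_sum fun j _ => mul_log_mid _ _ (hx.2 j).1 (hz.2 j).1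
  have e5 := mul_log_mid (1 - ∑ j, x j) (1 - ∑ j, z j) (by linarith [hx.1]) (by linarith [hz.1])
  have e6 : (1 - ∑ j, x j + (1 - ∑ j, z j)) / 2 = 1 - (∑ j, x j + ∑ j, z j) / 2 := by ring
  rw [e6] at e5
  simp only [e, e2, e3]
  have e7 : 0 ≤ α * (∑ j, x j - ∑ j, z j) ^ 2 := by positivity
  nlinarith [e4, e5, e7]

theorem stmt_16 (m k n : ℕ) (hm : 2 ≤ m) (hk1 : 1 ≤ k) (hkm : k ≤ m - 1)
    (hn : 1 ≤ n) (lam Kii : ℝ) (hlam : 0 < lam) (hKii : 0 < Kii)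
    (y : Fin m) (q : Fin m → ℝ) :
    ∀ v : Fin m → ℝ,
      -- `v` maximizes `D_i` (in particular `−λnv` is dual feasible)
      (((∑ j, (-((lam * n) * v j)) = 0) ∧
          inTopkSimplex k y 1 (fun j => -((lam * n) * v j.1))) ∧
        ∀ v' : Fin m → ℝ,
          ((∑ j, (-((lam * n) * v' j)) = 0) ∧
            inTopkSimplex k y 1 (fun j => -((lam * n) * v' j.1))) →
          dualObjEnt lam Kii n y q v' ≤ dualObjEnt lam Kii n y q v) ↔
      -- iff `⟨1, v⟩ = 0` and `−v^{\y} = (1/(λn))·x*` where `x* = −λn·v^{\y}` is the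
      -- unique minimizer of the proximal problem over `Δ^α_k`
      ((∑ j, v j = 0) ∧
        inTopkSimplex k y 1 (fun j => -((lam * n) * v j.1)) ∧
        (∀ x : {j : Fin m // j ≠ y} → ℝ, inTopkSimplex k y 1 x →
          proxObjEnt lam Kii n y q (fun j => -((lam * n) * v j.1)) ≤
            proxObjEnt lam Kii n y q x) ∧
        (∀ x : {j : Fin m // j ≠ y} → ℝ, inTopkSimplex k y 1 x →
          (∀ x' : {j : Fin m // j ≠ y} → ℝ, inTopkSimplex k y 1 x' →
            proxObjEnt lam Kii n y q x ≤ proxObjEnt lam Kii n y q x') →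
          x = fun j => -((lam * n) * v j.1))) := by
  have hn0 : (0:ℝ) < n := by exact_mod_cast hn
  have hc : 0 < lam * n := by positivity
  have hsum : ∀ v : Fin m → ℝ, (∑ j, (-((lam * n) * v j)) = 0) ↔ ∑ j, v j = 0 := by
    intro v
    rw [Finset.sum_neg_distrib, ← Finset.mul_sum, neg_eq_zero, mul_eq_zero]
    exact ⟨fun h => h.resolve_left hc.ne', Or.inr⟩
  intro v
  simp only [hsum]
  constructor
  · rintro ⟨⟨hv, hf⟩, hmax⟩
    have hmin : ∀ x : {j : Fin m // j ≠ y} → ℝ, inTopkSimplex k y 1 x →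
          proxObjEnt lam Kii n y q (fun j => -((lam * n) * v j.1)) ≤
            proxObjEnt lam Kii n y q x := by
      intro x hx
      let v' : Fin m → ℝ := fun j =>
        if h : j ≠ y then -(x ⟨j, h⟩) / (lam * n) else (∑ l, x l) / (lam * n)
      have hx' : (fun j : {j : Fin m // j ≠ y} => -((lam * n) * v' j.1)) = x := by
        funext j
        have : v' j.1 = -(x j) / (lam * n) := by simp [v', j.2]
        rw [this]; field_simp
      have hs : ∑ j, v' j = 0 := by
        rw [sum_split_ne y]
        have h1 : v' y = (∑ l, x l) / (lam * n) := by simp [v']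
        have h2 : ∀ j : {j : Fin m // j ≠ y}, v' j.1 = -(x j) / (lam * n) := by
          intro j; simp [v', j.2]
        simp only [h1, h2]
        rw [← Finset.sum_div, Finset.sum_neg_distrib]; ring
      have h := hmax v' ⟨hs, by rw [hx']; exact hx⟩
      rw [dual_eq_prox n hn lam Kii hlam y q v' hs, dual_eq_prox n hn lam Kii hlam y q v hv,
        hx'] at h
      have hp : 0 < 1 / (n:ℝ) := by positivity
      rw [neg_mul, neg_mul, neg_le_neg_iff] at h
      exact le_of_mul_le_mul_left h hp
    refine ⟨hv, hf, hmin, fun x hx hxm => ?_⟩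
    have h1 := prox_mid n hn lam Kii hlam hKii y q x _ hx hf
    have h2 := hmin _ (topk_mid y x _ hx hf)
    have h3 := hxm _ hf
    have hα : 0 < Kii / (lam * n) / 8 := by positivity
    have h4 : ∑ j : {j : Fin m // j ≠ y}, (x j - (-((lam * n) * v j.1))) ^ 2 ≤ 0 := by
      by_contra hcon
      push Not at hcon
      have := mul_pos hα hcon
      linarith
    have h5 : ∑ j : {j : Fin m // j ≠ y}, (x j - (-((lam * n) * v j.1))) ^ 2 = 0 :=
      le_antisymm h4 (Finset.sum_nonneg fun j _ => sq_nonneg _)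
    rw [Finset.sum_eq_zero_iff_of_nonneg (fun j _ => sq_nonneg _)] at h5
    funext j
    exact sub_eq_zero.mp (pow_eq_zero_iff (two_ne_zero) |>.mp (h5 j (Finset.mem_univ j)))
  · rintro ⟨hv, hf, hmin, -⟩
    refine ⟨⟨hv, hf⟩, fun v' hv' => ?_⟩
    rw [dual_eq_prox n hn lam Kii hlam y q v' hv'.1, dual_eq_prox n hn lam Kii hlam y q v hv]
    have hp : 0 ≤ 1 / (n:ℝ) := by positivity
    rw [neg_mul, neg_mul, neg_le_neg_iff]
    exact mul_le_mul_of_nonneg_left (hmin _ hv'.2) hp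
end

section
/- Fix m ≥ 2, a nonempty proper subset Y ⊊ {1,…,m} with complement Ȳ, γ ≥ 0, λ > 0, n ≥ 1, K_ii > 0, and q ∈ ℝ^m. Let L*_γ(w) = (1/2)( Σ_{y ∈ Y} w_y − Σ_{j ∈ Ȳ} w_j ) + (γ/2)‖w‖² if w ∈ S_Y and +∞ otherwise. Consider maximizing over v ∈ ℝ^m the function D_i(v) = −(1/n)·L*_γ(−λ n v) − (λ/2)( K_ii·⟨v, v⟩ + 2⟨q, v⟩ ). Then the maximizer v* satisfies (v*_y)_{y ∈ Y} = p and (v*_j)_{j ∈ Ȳ} = −p̄, where (p, p̄) is the Euclidean projection of (b, b̄) onto the bipartite simplex B(1/(λn)), with b = ρ·( 1/2 − q_y )_{y ∈ Y}, b̄ = ρ·( 1/2 + q_j )_{j ∈ Ȳ}, and ρ = 1/( K_ii + γ λ n ). -/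
open Finset

/-- Membership of `w` in the set `S_Y`. -/
def inSY {m : ℕ} (Y : Finset (Fin m)) (w : Fin m → ℝ) : Prop :=
  -∑ y ∈ Y, w y = ∑ j ∈ Yᶜ, w j ∧ ∑ j ∈ Yᶜ, w j ≤ 1 ∧
    (∀ y ∈ Y, w y ≤ 0) ∧ ∀ j ∈ Yᶜ, 0 ≤ w j

/-- The dual SDCA objective for the smooth multilabel SVM, evaluated at a
feasible `v`: `D_i(v) = −(1/n)·L*_γ(−λnv) − (λ/2)(K_ii⟨v,v⟩ + 2⟨q,v⟩)`, with
`L*_γ(w) = ½(∑_{y∈Y} w_y − ∑_{j∈Ȳ} w_j) + (γ/2)‖w‖²`. -/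
noncomputable def dualObjMlSvm {m : ℕ} (Y : Finset (Fin m)) (γ lam Kii : ℝ)
    (n : ℕ) (q v : Fin m → ℝ) : ℝ :=
  -(1/(n:ℝ)) * ((1/2) * (∑ y ∈ Y, (-((lam * n) * v y)) -
        ∑ j ∈ Yᶜ, (-((lam * n) * v j))) +
      γ/2 * ∑ j, ((lam * n) * v j)^2) -
    (lam/2) * (Kii * ∑ j, (v j)^2 + 2 * ∑ j, q j * v j)

/-- Membership of `(x, z)` in the bipartite simplex `B(r)` (coordinates of `x`
indexed by `Y`, coordinates of `z` indexed by `Yᶜ`). -/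
def inBipartiteSimplex {m : ℕ} (Y : Finset (Fin m)) (r : ℝ)
    (x z : Fin m → ℝ) : Prop :=
  (∑ y ∈ Y, x y = ∑ j ∈ Yᶜ, z j) ∧ (∑ j ∈ Yᶜ, z j ≤ r) ∧
    (∀ y ∈ Y, 0 ≤ x y) ∧ ∀ j ∈ Yᶜ, 0 ≤ z j

/-- Squared Euclidean distance from `(x, z)` to `(b, b̄)` with
`b = ρ(1/2 − q_y)_{y∈Y}`, `b̄ = ρ(1/2 + q_j)_{j∈Ȳ}`, `ρ = 1/(K_ii + γλn)`. -/
noncomputable def distToB {m : ℕ} (Y : Finset (Fin m)) (γ lam Kii : ℝ) (n : ℕ)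
    (q x z : Fin m → ℝ) : ℝ :=
  ∑ y ∈ Y, (x y - (1/(Kii + γ * lam * n)) * (1/2 - q y))^2 +
    ∑ j ∈ Yᶜ, (z j - (1/(Kii + γ * lam * n)) * (1/2 + q j))^2

lemma obj_eq {m : ℕ} (Y : Finset (Fin m)) (γ lam Kii : ℝ) (n : ℕ) (hn : (n:ℝ) ≠ 0)
    (hk : Kii + γ * lam * n ≠ 0) (q v : Fin m → ℝ) :
    dualObjMlSvm Y γ lam Kii n q v =
      -(lam * (Kii + γ * lam * n) / 2) *
        (distToB Y γ lam Kii n q v (fun j => - v j) -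
          distToB Y γ lam Kii n q (fun _ => 0) (fun _ => 0)) := by
  unfold dualObjMlSvm distToB
  rw [← Finset.sum_add_sum_compl Y (fun j => ((lam * n) * v j)^2),
    ← Finset.sum_add_sum_compl Y (fun j => (v j)^2),
    ← Finset.sum_add_sum_compl Y (fun j => q j * v j)]
  have e1 : ∀ s : Finset (Fin m), ∑ j ∈ s, ((lam * n) * v j)^2 =
      (lam * n)^2 * ∑ j ∈ s, (v j)^2 := by
    intro s; rw [Finset.mul_sum]; exact Finset.sum_congr rfl (fun j _ => by ring)
  have e2 : ∀ s : Finset (Fin m), ∑ j ∈ s, (-((lam * n) * v j)) =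
      -(lam * n) * ∑ j ∈ s, v j := by
    intro s; rw [Finset.mul_sum]; exact Finset.sum_congr rfl (fun j _ => by ring)
  generalize hr : 1 / (Kii + γ * lam * n) = r
  have e3 : ∑ y ∈ Y, (v y - r * (1/2 - q y))^2 = ∑ y ∈ Y, (v y)^2 - r * ∑ y ∈ Y, v y
      + 2 * r * ∑ y ∈ Y, q y * v y + ∑ y ∈ Y, (0 - r * (1/2 - q y))^2 := by
    simp only [Finset.mul_sum, ← Finset.sum_add_distrib, ← Finset.sum_sub_distrib]
    exact Finset.sum_congr rfl (fun j _ => by ring)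
  have e4 : ∑ y ∈ Yᶜ, (-v y - r * (1/2 + q y))^2 = ∑ y ∈ Yᶜ, (v y)^2 + r * ∑ y ∈ Yᶜ, v y
      + 2 * r * ∑ y ∈ Yᶜ, q y * v y + ∑ y ∈ Yᶜ, (0 - r * (1/2 + q y))^2 := by
    simp only [Finset.mul_sum, ← Finset.sum_add_distrib]
    exact Finset.sum_congr rfl (fun j _ => by ring)
  rw [e1, e1, e2, e2, e3, e4]
  generalize ∑ y ∈ Y, (0 - r * (1/2 - q y))^2 = c1
  generalize ∑ y ∈ Yᶜ, (0 - r * (1/2 + q y))^2 = c2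
  have hr' : (Kii + γ * lam * n) * r = 1 := by rw [← hr]; exact mul_one_div_cancel hk
  have ht : (1 / (n:ℝ)) * n = 1 := one_div_mul_cancel hn
  generalize 1 / (n:ℝ) = t at ht ⊢
  generalize ∑ y ∈ Y, v y = A
  generalize ∑ y ∈ Yᶜ, v y = B
  generalize ∑ y ∈ Y, (v y)^2 = S
  generalize ∑ y ∈ Yᶜ, (v y)^2 = S'
  generalize ∑ y ∈ Y, q y * v y = Q
  generalize ∑ y ∈ Yᶜ, q y * v y = Q'
  linear_combination (lam / 2 * (A - B) - γ / 2 * lam^2 * n * (S + S')) * ht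
    - (lam / 2 * (A - B) - lam * (Q + Q')) * hr'

lemma feas_iff {m : ℕ} (Y : Finset (Fin m)) (c : ℝ) (hc : 0 < c) (v : Fin m → ℝ) :
    inSY Y (fun j => -(c * v j)) ↔ inBipartiteSimplex Y (1 / c) v (fun j => - v j) := by
  unfold inSY inBipartiteSimplex
  simp only [Finset.sum_neg_distrib, ← Finset.mul_sum, neg_neg]
  refine and_congr ?_ (and_congr ?_ (and_congr ?_ ?_))
  · rw [← mul_neg, mul_right_inj' hc.ne']
  · rw [le_div_iff₀ hc, neg_mul, mul_comm]
  · refine forall₂_congr fun y _ => ?_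
    rw [neg_nonpos, mul_nonneg_iff_of_pos_left hc]
  · refine forall₂_congr fun y _ => ?_
    rw [← mul_neg, mul_nonneg_iff_of_pos_left hc]

theorem stmt_18 (m n : ℕ) (hm : 2 ≤ m) (hn : 1 ≤ n)
    (Y : Finset (Fin m)) (hY1 : Y.Nonempty) (hY2 : Y ≠ Finset.univ)
    (γ lam Kii : ℝ) (hγ : 0 ≤ γ) (hlam : 0 < lam) (hKii : 0 < Kii)
    (q : Fin m → ℝ) :
    ∀ vstar : Fin m → ℝ,
      -- `vstar` maximizes `D_i` (in particular `−λn·vstar ∈ S_Y`)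
      (inSY Y (fun j => -((lam * n) * vstar j)) ∧
        ∀ v : Fin m → ℝ, inSY Y (fun j => -((lam * n) * v j)) →
          dualObjMlSvm Y γ lam Kii n q v ≤ dualObjMlSvm Y γ lam Kii n q vstar) →
      ∀ p pb : Fin m → ℝ,
        -- `(p, pb)` is the Euclidean projection of `(b, b̄)` onto `B(1/(λn))`
        (inBipartiteSimplex Y (1/(lam * n)) p pb ∧
          ∀ x z : Fin m → ℝ, inBipartiteSimplex Y (1/(lam * n)) x z →
            distToB Y γ lam Kii n q p pb ≤ distToB Y γ lam Kii n q x z) →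
        (∀ y ∈ Y, vstar y = p y) ∧ (∀ j ∈ Yᶜ, vstar j = -pb j) := by
  intro v ⟨hv, hmax⟩ p pb ⟨hp, hmin⟩
  have hn0 : (0:ℝ) < n := by exact_mod_cast hn
  have hk : 0 < Kii + γ * lam * n := by positivity
  have hc : 0 < lam * n := by positivity
  rw [feas_iff Y _ hc] at hv
  -- the maximizer is at least as close to the target as the projection
  have h1 : distToB Y γ lam Kii n q v (fun j => - v j) ≤ distToB Y γ lam Kii n q p pb := by
    set w : Fin m → ℝ := fun j => if j ∈ Y then p j else - pb j with hw
    have w1 : ∀ y ∈ Y, w y = p y := fun y hy => by simp [hw, hy]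
    have w2 : ∀ y ∈ Yᶜ, - w y = pb y := fun y hy => by
      simp [hw, Finset.mem_compl.1 hy]
    have hwf : inBipartiteSimplex Y (1 / (lam * n)) w (fun j => - w j) := by
      obtain ⟨a1, a2, a3, a4⟩ := hp
      refine ⟨?_, ?_, ?_, ?_⟩
      · rw [Finset.sum_congr rfl w1, Finset.sum_congr rfl w2, a1]
      · rw [Finset.sum_congr rfl w2]; exact a2
      · intro y hy; rw [w1 y hy]; exact a3 y hy
      · intro y hy; simp only [w2 y hy]; exact a4 y hy
    have hd : distToB Y γ lam Kii n q w (fun j => - w j) = distToB Y γ lam Kii n q p pb := by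
      unfold distToB
      congr 1
      · exact Finset.sum_congr rfl (fun y hy => by rw [w1 y hy])
      · exact Finset.sum_congr rfl (fun y hy => by simp only [w2 y hy])
    have h := hmax w ((feas_iff Y _ hc w).2 hwf)
    rw [obj_eq Y γ lam Kii n hn0.ne' hk.ne', obj_eq Y γ lam Kii n hn0.ne' hk.ne', hd] at h
    have hpos : 0 < lam * (Kii + γ * lam * n) / 2 := by positivity
    rw [neg_mul, neg_mul, neg_le_neg_iff, mul_le_mul_iff_right₀ hpos] at h
    linarith
  -- the midpoint is feasible
  have h2 := hmin (fun j => (v j + p j) / 2) (fun j => (- v j + pb j) / 2) (by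
    obtain ⟨a1, a2, a3, a4⟩ := hp
    obtain ⟨b1, b2, b3, b4⟩ := hv
    refine ⟨?_, ?_, ?_, ?_⟩
    · rw [← Finset.sum_div, ← Finset.sum_div, Finset.sum_add_distrib, Finset.sum_add_distrib,
        a1, b1]
    · rw [← Finset.sum_div, Finset.sum_add_distrib]; linarith
    · intro y hy; have := a3 y hy; have := b3 y hy; simp only; linarith
    · intro y hy; have := a4 y hy; have := b4 y hy; simp only at *; linarith)
  have h3 : distToB Y γ lam Kii n q (fun j => (v j + p j) / 2) (fun j => (- v j + pb j) / 2) =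
      1/2 * distToB Y γ lam Kii n q v (fun j => - v j) + 1/2 * distToB Y γ lam Kii n q p pb
      - 1/4 * (∑ y ∈ Y, (v y - p y)^2 + ∑ y ∈ Yᶜ, (v y + pb y)^2) := by
    have e : ∀ (s : Finset (Fin m)) (x z b : Fin m → ℝ),
        ∑ y ∈ s, ((x y + z y) / 2 - b y)^2 = 1/2 * ∑ y ∈ s, (x y - b y)^2
          + 1/2 * ∑ y ∈ s, (z y - b y)^2 - 1/4 * ∑ y ∈ s, (x y - z y)^2 := by
      intro s x z b
      simp only [Finset.mul_sum, ← Finset.sum_add_distrib, ← Finset.sum_sub_distrib]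
      exact Finset.sum_congr rfl (fun j _ => by ring)
    have e' : ∑ y ∈ Yᶜ, (v y + pb y)^2 = ∑ y ∈ Yᶜ, (- v y - pb y)^2 :=
      Finset.sum_congr rfl (fun j _ => by ring)
    unfold distToB
    rw [e Y v p (fun y => (1/(Kii + γ * lam * n)) * (1/2 - q y)),
      e Yᶜ (fun y => - v y) pb (fun y => (1/(Kii + γ * lam * n)) * (1/2 + q y)), e']
    ring
  have s1 : 0 ≤ ∑ y ∈ Y, (v y - p y)^2 := Finset.sum_nonneg fun _ _ => sq_nonneg _
  have s2 : 0 ≤ ∑ y ∈ Yᶜ, (v y + pb y)^2 := Finset.sum_nonneg fun _ _ => sq_nonneg _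
  have z1 : ∑ y ∈ Y, (v y - p y)^2 = 0 := by linarith
  have z2 : ∑ y ∈ Yᶜ, (v y + pb y)^2 = 0 := by linarith
  rw [Finset.sum_eq_zero_iff_of_nonneg fun _ _ => sq_nonneg _] at z1 z2
  refine ⟨fun y hy => ?_, fun y hy => ?_⟩
  · have := pow_eq_zero_iff (two_ne_zero) |>.1 (z1 y hy); linarith
  · have := pow_eq_zero_iff (two_ne_zero) |>.1 (z2 y hy); linarith
end
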